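/- There exists a finite set S ⊂ ℂ containing 0 such that for every λ ∉ S and every (a,b,c,p) ∈ ℂ⁴ with c ≠ 0 satisfying λp² = −2a, λ²b = 4ac, 12ca³ = (2c³+1)λ, and 64c⁶ − (16λ⁶ − 32)c³ + λ⁶ = 0, the orbit of the plane W(a,b,c,p) under the combined action of G × H on subspaces of ℂ⁶ has exactly 81 · 18 = 1458 elements, each of which is a line on X_λ. -/

import Mathlib

noncomputable section

/-- The first cubic form defining the (3,3) pencil `X_λ`. -/
def Fcubic (l : ℂ) (x : Fin 6 → ℂ) : ℂ :=
  x 0 ^ 3 + x 1 ^ 3 + x 2 ^ 3 - 3 * l * x 3 * x 4 * x 5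

/-- The second cubic form defining the (3,3) pencil `X_λ`. -/
def Gcubic (l : ℂ) (x : Fin 6 → ℂ) : ℂ :=
  x 3 ^ 3 + x 4 ^ 3 + x 5 ^ 3 - 3 * l * x 0 * x 1 * x 2

/-- The plane `W(a,b,c,p) ⊆ ℂ⁶`, spanned by `(1,−1,0,p,−p,0)` and `(a,a,b,c,c,1)`. -/
def linePlane (a b c p : ℂ) : Submodule ℂ (Fin 6 → ℂ) :=
  Submodule.span ℂ {![1, -1, 0, p, -p, 0], ![a, a, b, c, c, 1]}

/-- The system of equations characterizing the 36 lines of Lemma 2.3. -/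
def lineEqs (l a b c p : ℂ) : Prop :=
  l * p ^ 2 = -2 * a ∧ l ^ 2 * b = 4 * a * c ∧
    12 * c * a ^ 3 = (2 * c ^ 3 + 1) * l ∧
    64 * c ^ 6 - (16 * l ^ 6 - 32) * c ^ 3 + l ^ 6 = 0

/-- The subgroup `G ≤ (ℂˣ)⁶` generated by `α₁, α₂, α₃`, where `ω = ζ³`. -/
def Gsub (z : ℂˣ) : Subgroup (Fin 6 → ℂˣ) :=
  Subgroup.closure
    {![1, z ^ 3, (z ^ 3)⁻¹, 1, 1, 1],
      ![1, 1, z ^ 3, z, z, (z ^ 2)⁻¹],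
      ![1, 1, 1, 1, z ^ 3, (z ^ 3)⁻¹]}

/-- The subgroup `H ≤ S₆` generated by all permutations of the indices `{0,1,2}`
and all permutations of the indices `{3,4,5}`. -/
def Hsub : Subgroup (Equiv.Perm (Fin 6)) :=
  Subgroup.closure
    ({σ : Equiv.Perm (Fin 6) | ∀ i : Fin 6, 3 ≤ (i : ℕ) → σ i = i} ∪
      {σ : Equiv.Perm (Fin 6) | ∀ i : Fin 6, (i : ℕ) < 3 → σ i = i})

/-- Componentwise multiplication by `g ∈ (ℂˣ)⁶` as a linear automorphism-inducing map. -/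
def diagMap (g : Fin 6 → ℂˣ) : (Fin 6 → ℂ) →ₗ[ℂ] (Fin 6 → ℂ) :=
  LinearMap.pi fun i => (g i : ℂ) • LinearMap.proj i

/-- Coordinate permutation `x ↦ x ∘ σ` as a linear map. -/
def permMap (σ : Equiv.Perm (Fin 6)) : (Fin 6 → ℂ) →ₗ[ℂ] (Fin 6 → ℂ) :=
  LinearMap.funLeft ℂ ℂ σ

def blk (σ : Equiv.Perm (Fin 6)) : Prop := ∀ i : Fin 6, (i : ℕ) < 3 ↔ ((σ i : Fin 6) : ℕ) < 3

instance : DecidablePred blk := fun σ => by unfold blk; infer_instance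

def Rset : Finset (Equiv.Perm (Fin 6)) :=
  Finset.univ.filter fun σ => blk σ ∧ σ.symm 0 < σ.symm 1

def tau : Equiv.Perm (Fin 6) := Equiv.swap 0 1 * Equiv.swap 3 4

set_option maxRecDepth 100000 in
theorem Rset_card : Rset.card = 18 := by decide +kernel

theorem blk_vals (σ : Equiv.Perm (Fin 6)) (h : blk σ) :
    (σ 0, σ 1, σ 2) ∈ ([(0,1,2),(0,2,1),(1,0,2),(1,2,0),(2,0,1),(2,1,0)] : List (Fin 6 × Fin 6 × Fin 6)) ∧
    (σ 3, σ 4, σ 5) ∈ ([(3,4,5),(3,5,4),(4,3,5),(4,5,3),(5,3,4),(5,4,3)] : List (Fin 6 × Fin 6 × Fin 6)) := by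
  have ne : ∀ i j : Fin 6, i ≠ j → σ i ≠ σ j := fun i j hij => σ.injective.ne hij
  have lo : ∀ a : Fin 6, (a : ℕ) < 3 → a = 0 ∨ a = 1 ∨ a = 2 := by decide
  have hi : ∀ a : Fin 6, ¬ (a : ℕ) < 3 → a = 3 ∨ a = 4 ∨ a = 5 := by decide
  have g0 := lo _ ((h 0).1 (by decide))
  have g1 := lo _ ((h 1).1 (by decide))
  have g2 := lo _ ((h 2).1 (by decide))
  have g3 := hi (σ 3) (fun e => absurd ((h 3).2 e) (by decide))
  have g4 := hi (σ 4) (fun e => absurd ((h 4).2 e) (by decide))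
  have g5 := hi (σ 5) (fun e => absurd ((h 5).2 e) (by decide))
  have n01 := ne 0 1 (by decide)
  have n02 := ne 0 2 (by decide)
  have n12 := ne 1 2 (by decide)
  have n34 := ne 3 4 (by decide)
  have n35 := ne 3 5 (by decide)
  have n45 := ne 4 5 (by decide)
  clear ne lo hi h
  generalize σ 0 = a at *
  generalize σ 1 = b at *
  generalize σ 2 = c at *
  generalize σ 3 = d at *
  generalize σ 4 = e at *
  generalize σ 5 = f at *
  constructor
  · clear g3 g4 g5 n34 n35 n45
    rcases g0 with rfl | rfl | rfl <;> rcases g1 with rfl | rfl | rfl <;>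
      first
      | exact absurd rfl n01
      | (rcases g2 with rfl | rfl | rfl <;>
          first
          | exact absurd rfl n02
          | exact absurd rfl n12
          | simp)
  · clear g0 g1 g2 n01 n02 n12
    rcases g3 with rfl | rfl | rfl <;> rcases g4 with rfl | rfl | rfl <;>
      first
      | exact absurd rfl n34
      | (rcases g5 with rfl | rfl | rfl <;>
          first
          | exact absurd rfl n35
          | exact absurd rfl n45
          | simp)

theorem perm_ext6 {σ τ : Equiv.Perm (Fin 6)} (h0 : σ 0 = τ 0) (h1 : σ 1 = τ 1) (h2 : σ 2 = τ 2)
    (h3 : σ 3 = τ 3) (h4 : σ 4 = τ 4) (h5 : σ 5 = τ 5) : σ = τ := by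
  refine Equiv.ext fun i => ?_
  fin_cases i
  · exact h0
  · exact h1
  · exact h2
  · exact h3
  · exact h4
  · exact h5

theorem blk_cases (σ : Equiv.Perm (Fin 6)) (hσ : blk σ) (h2 : σ 2 = 2) (h5 : σ 5 = 5) :
    σ = 1 ∨ σ = tau ∨ σ = Equiv.swap 0 1 ∨ σ = Equiv.swap 3 4 := by
  obtain ⟨m1, m2⟩ := blk_vals σ hσ
  simp only [List.mem_cons, Prod.mk.injEq, List.not_mem_nil, or_false, h2, h5] at m1 m2
  have q1 : (σ 0 = 0 ∧ σ 1 = 1) ∨ (σ 0 = 1 ∧ σ 1 = 0) := by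
    simpa using m1
  have q2 : (σ 3 = 3 ∧ σ 4 = 4) ∨ (σ 3 = 4 ∧ σ 4 = 3) := by
    simpa using m2
  rcases q1 with ⟨h0, h1⟩ | ⟨h0, h1⟩ <;> rcases q2 with ⟨h3, h4⟩ | ⟨h3, h4⟩
  · refine Or.inl (perm_ext6 ?_ ?_ ?_ ?_ ?_ ?_) <;> simp [*]
  · refine Or.inr (Or.inr (Or.inr (perm_ext6 ?_ ?_ ?_ ?_ ?_ ?_))) <;>
      simp only [*] <;> decide
  · refine Or.inr (Or.inr (Or.inl (perm_ext6 ?_ ?_ ?_ ?_ ?_ ?_))) <;>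
      simp only [*] <;> decide
  · refine Or.inr (Or.inl (perm_ext6 ?_ ?_ ?_ ?_ ?_ ?_)) <;>
      simp only [*] <;> decide

theorem blk_mul {σ τ : Equiv.Perm (Fin 6)} (h : blk σ) (h' : blk τ) : blk (σ * τ) := by
  intro i
  rw [h' i, h (τ i)]; rfl

theorem blk_inv {σ : Equiv.Perm (Fin 6)} (h : blk σ) : blk σ⁻¹ := by
  intro i
  rw [h (σ⁻¹ i)]; simp

theorem blk_tau : blk tau := by decide +kernel

theorem mem_Hsub (σ : Equiv.Perm (Fin 6)) : σ ∈ Hsub ↔ blk σ := by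
  constructor
  · intro h
    induction h using Subgroup.closure_induction with
    | mem x hx =>
      have key : ∀ σ : Equiv.Perm (Fin 6), (∀ i : Fin 6, 3 ≤ (i : ℕ) → σ i = i) → blk σ := by
        intro σ h i
        constructor
        · intro hi
          by_contra hc
          have := h (σ i) (by omega)
          have := σ.injective this
          omega
        · intro hi
          by_contra hc
          rw [h i (by omega)] at hi
          omega
      have key2 : ∀ σ : Equiv.Perm (Fin 6), (∀ i : Fin 6, (i : ℕ) < 3 → σ i = i) → blk σ := by
        intro σ h i
        constructor
        · intro hi
          rw [h i hi]; exact hi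
        · intro hi
          have := h (σ i) hi
          have := σ.injective this
          omega
      rcases hx with hx | hx
      · exact key x hx
      · exact key2 x hx
    | one => intro i; rfl
    | mul x y _ _ hx hy => exact blk_mul hx hy
    | inv x _ hx => exact blk_inv hx
  · intro h
    let x : Equiv.Perm (Fin 6) :=
      Equiv.Perm.ofSubtype (σ.subtypePerm (p := fun i : Fin 6 => (i : ℕ) < 3) fun i => (h i).symm)
    have q : σ = x * (x⁻¹ * σ) := by group
    rw [q]
    refine Subgroup.mul_mem _ (Subgroup.subset_closure (Or.inl ?_))
      (Subgroup.subset_closure (Or.inr ?_))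
    · intro i hi
      exact Equiv.Perm.ofSubtype_apply_of_not_mem _ (not_lt.2 hi)
    · intro i hi
      rw [Equiv.Perm.mul_apply, Equiv.Perm.inv_eq_iff_eq]
      exact (Equiv.Perm.ofSubtype_apply_of_mem
        (σ.subtypePerm (p := fun i : Fin 6 => (i : ℕ) < 3) fun i => (h i).symm) hi).symm

/-! Pluecker coordinates -/

def plk (x y : Fin 6 → ℂ) (i j : Fin 6) : ℂ := x i * y j - x j * y i

theorem plk_span {u v u' v' : Fin 6 → ℂ}
    (h : Submodule.span ℂ {u', v'} ≤ Submodule.span ℂ {u, v}) :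
    ∃ k : ℂ, ∀ i j, plk u' v' i j = k * plk u v i j := by
  have hu : u' ∈ Submodule.span ℂ {u, v} := h (Submodule.subset_span (by simp))
  have hv : v' ∈ Submodule.span ℂ {u, v} := h (Submodule.subset_span (by simp))
  rw [Submodule.mem_span_pair] at hu hv
  obtain ⟨a, b, rfl⟩ := hu
  obtain ⟨c, d, rfl⟩ := hv
  refine ⟨a * d - b * c, fun i j => ?_⟩
  simp only [plk, Pi.add_apply, Pi.smul_apply, smul_eq_mul]
  ring

def uu (p : ℂ) : Fin 6 → ℂ := ![1, -1, 0, p, -p, 0]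
def vv (a b c : ℂ) : Fin 6 → ℂ := ![a, a, b, c, c, 1]

theorem map_line (g : Fin 6 → ℂˣ) (σ : Equiv.Perm (Fin 6)) (a b c p : ℂ) :
    Submodule.map (diagMap g) (Submodule.map (permMap σ) (linePlane a b c p)) =
      Submodule.span ℂ {(fun i => (g i : ℂ) * uu p (σ i)), (fun i => (g i : ℂ) * vv a b c (σ i))} := by
  unfold linePlane
  rw [Submodule.map_span, Submodule.map_span, Set.image_pair, Set.image_pair]
  rfl

set_option maxHeartbeats 1000000 in
theorem core (a b c p : ℂ) (ha : a ≠ 0) (hb : b ≠ 0) (hc : c ≠ 0) (hp : p ≠ 0)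
    (h1 : c - a * p ≠ 0) (h2 : c + a * p ≠ 0) (h : Fin 6 → ℂ) (hh : ∀ i, h i ≠ 0)
    (k : ℂ) (hk : k ≠ 0) (π : Equiv.Perm (Fin 6)) (hπ : blk π)
    (H : ∀ i j, h i * h j * plk (uu p) (vv a b c) i j = k * plk (uu p) (vv a b c) (π i) (π j)) :
    (π = 1 ∨ π = tau) ∧ ∀ i, h i = h 0 := by
  have P01 : plk (uu p) (vv a b c) 0 1 = 2 * a := by simp [plk, uu, vv]; ring
  have P10 : plk (uu p) (vv a b c) 1 0 = -(2 * a) := by simp [plk, uu, vv]; ring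
  have P02 : plk (uu p) (vv a b c) 0 2 = b := by simp [plk, uu, vv]
  have P12 : plk (uu p) (vv a b c) 1 2 = -b := by simp [plk, uu, vv]
  have P03 : plk (uu p) (vv a b c) 0 3 = c - a * p := by simp [plk, uu, vv]; ring
  have P04 : plk (uu p) (vv a b c) 0 4 = c + a * p := by simp [plk, uu, vv]; ring
  have P05 : plk (uu p) (vv a b c) 0 5 = 1 := by simp [plk, uu, vv]
  have P13 : plk (uu p) (vv a b c) 1 3 = -(c + a * p) := by simp [plk, uu, vv]; ring
  have P14 : plk (uu p) (vv a b c) 1 4 = -(c - a * p) := by simp [plk, uu, vv]; ring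
  have P15 : plk (uu p) (vv a b c) 1 5 = -1 := by simp [plk, uu, vv]
  have P23 : plk (uu p) (vv a b c) 2 3 = -(b * p) := by simp [plk, uu, vv]; ring
  have P24 : plk (uu p) (vv a b c) 2 4 = b * p := by simp [plk, uu, vv]; ring
  have P25 : plk (uu p) (vv a b c) 2 5 = 0 := by simp [plk, uu, vv]
  have P34 : plk (uu p) (vv a b c) 3 4 = 2 * p * c := by simp [plk, uu, vv]; ring
  have P43 : plk (uu p) (vv a b c) 4 3 = -(2 * p * c) := by simp [plk, uu, vv]; ring
  have H25 := H 2 5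
  rw [P25, mul_zero] at H25
  have Z : plk (uu p) (vv a b c) (π 2) (π 5) = 0 := by
    rcases mul_eq_zero.1 H25.symm with h | h
    · exact absurd h hk
    · exact h
  obtain ⟨m1, m2⟩ := blk_vals π hπ
  simp only [List.mem_cons, Prod.mk.injEq, List.not_mem_nil, or_false] at m1 m2
  have e2 : π 2 = 0 ∨ π 2 = 1 ∨ π 2 = 2 := by
    rcases m1 with m | m | m | m | m | m <;> simp [m.2.2]
  have e5 : π 5 = 3 ∨ π 5 = 4 ∨ π 5 = 5 := by
    rcases m2 with m | m | m | m | m | m <;> simp [m.2.2]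
  have f : π 2 = 2 ∧ π 5 = 5 := by
    clear H H25 m1 m2
    rcases e2 with e2 | e2 | e2 <;> rcases e5 with e5 | e5 | e5 <;> rw [e2, e5] at Z
    · exact absurd (P03.symm.trans Z) h1
    · exact absurd (P04.symm.trans Z) h2
    · exact absurd (P05.symm.trans Z) one_ne_zero
    · exact absurd (P13.symm.trans Z) (neg_ne_zero.2 h2)
    · exact absurd (P14.symm.trans Z) (neg_ne_zero.2 h1)
    · exact absurd (P15.symm.trans Z) (neg_ne_zero.2 one_ne_zero)
    · exact absurd (P23.symm.trans Z) (neg_ne_zero.2 (mul_ne_zero hb hp))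
    · exact absurd (P24.symm.trans Z) (mul_ne_zero hb hp)
    · exact ⟨e2, e5⟩
  have H01 := H 0 1
  have H02 := H 0 2
  have H12 := H 1 2
  have H05 := H 0 5
  have H23 := H 2 3
  have H24 := H 2 4
  have H34 := H 3 4
  have n0 := hh 0
  have n1 := hh 1
  have n2 := hh 2
  have n3 := hh 3
  have fin : ∀ k : ℂ, h 0 * h 1 = k → h 0 * h 2 = k → h 1 * h 2 = k → h 0 * h 5 = k →
      h 2 * h 3 = k → h 2 * h 4 = k → ∀ i, h i = h 0 := by
    intro k a1 a2 a3 a4 a5 a6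
    have q1 : h 1 = h 2 := mul_left_cancel₀ n0 (a1.trans a2.symm)
    have q2 : h 0 = h 1 := mul_right_cancel₀ n2 (a2.trans a3.symm)
    have q3 : h 5 = h 2 := mul_left_cancel₀ n0 (a4.trans a2.symm)
    have q4 : h 3 = h 0 := mul_left_cancel₀ n2 (by rw [a5, ← a2]; ring)
    have q5 : h 4 = h 0 := mul_left_cancel₀ n2 (by rw [a6, ← a2]; ring)
    intro i
    fin_cases i
    · rfl
    · exact q2.symm
    · exact (q2.trans q1).symm
    · exact q4
    · exact q5
    · exact q3.trans (q2.trans q1).symm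
  have hbp : b * p ≠ 0 := mul_ne_zero hb hp
  have hpc : 2 * p * c ≠ 0 := by simp [hp, hc]
  have ha2 : 2 * a ≠ 0 := by simp [ha]
  rcases blk_cases π hπ f.1 f.2 with e | e | e | e
  · refine ⟨Or.inl e, ?_⟩
    subst e
    simp only [Equiv.Perm.one_apply, P01, P02, P12, P05, P23, P24] at H01 H02 H12 H05 H23 H24
    apply fin k
    · exact mul_right_cancel₀ ha2 H01
    · exact mul_right_cancel₀ hb H02
    · exact mul_right_cancel₀ (neg_ne_zero.2 hb) H12
    · simpa using H05
    · exact mul_right_cancel₀ (neg_ne_zero.2 hbp) H23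
    · exact mul_right_cancel₀ hbp H24
  · refine ⟨Or.inr e, ?_⟩
    have t0 : π 0 = 1 := by rw [e]; decide
    have t1 : π 1 = 0 := by rw [e]; decide
    have t3 : π 3 = 4 := by rw [e]; decide
    have t4 : π 4 = 3 := by rw [e]; decide
    simp only [f.1, f.2, t0, t1, t3, t4, P01, P10, P15, P02, P12, P05, P23, P24] at H01 H02 H12 H05 H23 H24
    apply fin (-k)
    · apply mul_right_cancel₀ ha2; linear_combination H01
    · apply mul_right_cancel₀ hb; linear_combination H02
    · apply mul_right_cancel₀ hb; linear_combination -H12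
    · linear_combination H05
    · apply mul_right_cancel₀ hbp; linear_combination -H23
    · apply mul_right_cancel₀ hbp; linear_combination H24
  · exfalso
    have t0 : π 0 = 1 := by rw [e]; decide
    have t1 : π 1 = 0 := by rw [e]; decide
    have t3 : π 3 = 3 := by rw [e]; decide
    have t4 : π 4 = 4 := by rw [e]; decide
    simp only [f.1, f.2, t0, t1, t3, t4, P01, P10, P15, P02, P12, P05, P23, P24, P34, P43] at H01 H02 H12 H05 H23 H24 H34
    have a1 : h 0 * h 2 = -k := by apply mul_right_cancel₀ hb; linear_combination H02
    have a0 : h 0 * h 1 = -k := by apply mul_right_cancel₀ ha2; linear_combination H01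
    have a2 : h 1 * h 2 = -k := by apply mul_right_cancel₀ hb; linear_combination -H12
    have a3 : h 2 * h 3 = k := by apply mul_right_cancel₀ hbp; linear_combination -H23
    have a4 : h 2 * h 4 = k := by apply mul_right_cancel₀ hbp; linear_combination H24
    have a5 : h 3 * h 4 = k := by apply mul_right_cancel₀ hpc; linear_combination H34
    have q1 : h 1 = h 2 := mul_left_cancel₀ n0 (a0.trans a1.symm)
    have q2 : h 3 = h 2 := by
      have n4 := hh 4
      exact mul_right_cancel₀ n4 (a5.trans a4.symm)
    rw [q1] at a2
    rw [q2] at a3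
    apply hk
    linear_combination (a2 - a3) / 2
  · exfalso
    have t0 : π 0 = 0 := by rw [e]; decide
    have t1 : π 1 = 1 := by rw [e]; decide
    have t3 : π 3 = 4 := by rw [e]; decide
    have t4 : π 4 = 3 := by rw [e]; decide
    simp only [f.1, f.2, t0, t1, t3, t4, P01, P10, P15, P02, P12, P05, P23, P24, P34, P43] at H01 H02 H12 H05 H23 H24 H34
    have a1 : h 0 * h 2 = k := by apply mul_right_cancel₀ hb; linear_combination H02
    have a0 : h 0 * h 1 = k := by apply mul_right_cancel₀ ha2; linear_combination H01
    have a2 : h 1 * h 2 = k := by apply mul_right_cancel₀ hb; linear_combination -H12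
    have a3 : h 2 * h 3 = -k := by apply mul_right_cancel₀ hbp; linear_combination -H23
    have a4 : h 2 * h 4 = -k := by apply mul_right_cancel₀ hbp; linear_combination H24
    have a5 : h 3 * h 4 = -k := by apply mul_right_cancel₀ hpc; linear_combination H34
    have q1 : h 1 = h 2 := mul_left_cancel₀ n0 (a0.trans a1.symm)
    have q2 : h 3 = h 2 := by
      have n4 := hh 4
      exact mul_right_cancel₀ n4 (a5.trans a4.symm)
    rw [q1] at a2
    rw [q2] at a3
    apply hk
    linear_combination (a2 - a3) / (-2)

theorem inj_main (a b c p : ℂ) (ha : a ≠ 0) (hb : b ≠ 0) (hc : c ≠ 0) (hp : p ≠ 0)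
    (h1 : c - a * p ≠ 0) (h2 : c + a * p ≠ 0) (g g' : Fin 6 → ℂˣ) (hg : g 0 = 1) (hg' : g' 0 = 1)
    (σ σ' : Equiv.Perm (Fin 6)) (hσ : σ ∈ Rset) (hσ' : σ' ∈ Rset)
    (E : Submodule.map (diagMap g) (Submodule.map (permMap σ) (linePlane a b c p)) =
      Submodule.map (diagMap g') (Submodule.map (permMap σ') (linePlane a b c p))) :
    g = g' ∧ σ = σ' := by
  rw [map_line, map_line] at E
  obtain ⟨k, hk⟩ := plk_span E.ge
  simp only [Rset, Finset.mem_filter, Finset.mem_univ, true_and] at hσ hσ'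
  have hk0 : k ≠ 0 := by
    rintro rfl
    have := hk (σ'⁻¹ 0) (σ'⁻¹ 1)
    simp [plk, uu, vv] at this
    have n1 := (g' (σ'⁻¹ 0)).ne_zero
    have n2 := (g' (σ'⁻¹ 1)).ne_zero
    have : (g' (σ'⁻¹ 0) : ℂ) * (g' (σ'⁻¹ 1) : ℂ) * a = 0 := by linear_combination this / 2
    simp [ha] at this
  have key := core a b c p ha hb hc hp h1 h2
    (fun i => (g' (σ'⁻¹ i) : ℂ) * ((g (σ'⁻¹ i))⁻¹ : ℂˣ)) (by intro i; simp) k hk0 (σ * σ'⁻¹)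
    (blk_mul hσ.1 (blk_inv hσ'.1)) (by
      intro i j
      have := hk (σ'⁻¹ i) (σ'⁻¹ j)
      have ai : ∀ i, σ' (σ'⁻¹ i) = i := σ'.apply_symm_apply
      simp only [plk, ai] at this
      have n1 := (g (σ'⁻¹ i)).ne_zero
      have n2 := (g (σ'⁻¹ j)).ne_zero
      simp only [plk, Equiv.Perm.mul_apply, Units.val_inv_eq_inv_val]
      field_simp
      linear_combination this)
  obtain ⟨k1, k2⟩ := key
  constructor
  · have k3 : ∀ i, (g' i : ℂ) * ((g i)⁻¹ : ℂˣ) = 1 := by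
      intro i
      have e1 := k2 (σ' i)
      have e2 := k2 (σ' 0)
      have ai : ∀ i, σ'⁻¹ (σ' i) = i := σ'.symm_apply_apply
      simp only [ai, hg, hg'] at e1 e2
      rw [e1, ← e2]; simp
    funext i
    have := k3 i
    rw [← Units.val_mul, Units.val_eq_one] at this
    exact (mul_inv_eq_one.1 this).symm
  · rcases k1 with k1 | k1
    · exact mul_inv_eq_one.1 k1
    · exfalso
      have e : σ = tau * σ' := mul_inv_eq_iff_eq_mul.1 k1
      have i0 : σ.symm 0 = σ'.symm 1 := by
        rw [Equiv.symm_apply_eq, e]; simp [tau]; decide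
      have i1 : σ.symm 1 = σ'.symm 0 := by
        rw [Equiv.symm_apply_eq, e]; simp [tau]; decide
      have := hσ.2
      rw [i0, i1] at this
      exact absurd this (not_lt.2 hσ'.2.le)

theorem tau_line (g : Fin 6 → ℂˣ) (σ : Equiv.Perm (Fin 6)) (a b c p : ℂ) :
    Submodule.map (diagMap g) (Submodule.map (permMap (tau * σ)) (linePlane a b c p)) =
    Submodule.map (diagMap g) (Submodule.map (permMap σ) (linePlane a b c p)) := by
  have e1 : ∀ i, uu p (tau i) = - uu p i := by
    have t : tau 0 = 1 ∧ tau 1 = 0 ∧ tau 2 = 2 ∧ tau 3 = 4 ∧ tau 4 = 3 ∧ tau 5 = 5 := by decide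
    intro i; fin_cases i <;> simp [uu, t]
  have e2 : ∀ i, vv a b c (tau i) = vv a b c i := by
    have t : tau 0 = 1 ∧ tau 1 = 0 ∧ tau 2 = 2 ∧ tau 3 = 4 ∧ tau 4 = 3 ∧ tau 5 = 5 := by decide
    intro i; fin_cases i <;> simp [vv, t]
  rw [map_line, map_line]
  simp only [Equiv.Perm.mul_apply, e1, e2]
  apply le_antisymm
  · rw [Submodule.span_le, Set.pair_subset_iff]
    constructor
    · rw [SetLike.mem_coe, Submodule.mem_span_pair]
      exact ⟨-1, 0, by ext i; simp⟩
    · exact Submodule.subset_span (by simp)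
  · rw [Submodule.span_le, Set.pair_subset_iff]
    constructor
    · rw [SetLike.mem_coe, Submodule.mem_span_pair]
      exact ⟨-1, 0, by ext i; simp⟩
    · exact Submodule.subset_span (by simp)

/-! The diagonal group -/

def al1 (z : ℂˣ) : Fin 6 → ℂˣ := ![1, z ^ 3, (z ^ 3)⁻¹, 1, 1, 1]
def al2 (z : ℂˣ) : Fin 6 → ℂˣ := ![1, 1, z ^ 3, z, z, (z ^ 2)⁻¹]
def al3 (z : ℂˣ) : Fin 6 → ℂˣ := ![1, 1, 1, 1, z ^ 3, (z ^ 3)⁻¹]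

def ee (z : ℂˣ) (t : Fin 3 × Fin 9 × Fin 3) : Fin 6 → ℂˣ :=
  al1 z ^ (t.1 : ℕ) * al2 z ^ (t.2.1 : ℕ) * al3 z ^ (t.2.2 : ℕ)

theorem ee_inj (z : ℂˣ) (hz : IsPrimitiveRoot z 9) : Function.Injective (ee z) := by
  have hw : IsPrimitiveRoot (z ^ 3) 3 := hz.pow (by norm_num) (by norm_num)
  rintro ⟨i, j, k⟩ ⟨i', j', k'⟩ h
  have h1 := congrFun h 1
  have h3 := congrFun h 3
  have h4 := congrFun h 4
  simp [ee, al1, al2, al3] at h1 h3 h4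
  have q1 : i = i' := Fin.ext (hw.pow_inj i.2 i'.2 h1)
  have q2 : j = j' := Fin.ext (hz.pow_inj j.2 j'.2 h3)
  subst q2
  have q3 : k = k' := Fin.ext (hw.pow_inj k.2 k'.2 (mul_left_cancel h4))
  rw [q1, q3]

theorem zpow_red {M : Type*} [Group M] (x : M) (n : ℕ) (hn : 0 < n) (hx : x ^ n = 1) (m : ℤ) :
    ∃ i : Fin n, x ^ (i : ℕ) = x ^ m := by
  have hm := Int.emod_nonneg m (b := n) (by omega)
  have hm' := Int.emod_lt_of_pos m (b := n) (by omega)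
  refine ⟨⟨(m % n).toNat, by omega⟩, ?_⟩
  simp only
  rw [← zpow_natCast, Int.toNat_of_nonneg hm]
  conv_rhs => rw [← Int.emod_add_mul_ediv m n]
  rw [zpow_add, zpow_mul, zpow_natCast, hx]; simp

theorem Gsub_eq (z : ℂˣ) (hz : IsPrimitiveRoot z 9) : (Gsub z : Set (Fin 6 → ℂˣ)) = Set.range (ee z) := by
  have z9 : z ^ 9 = 1 := hz.pow_eq_one
  have a1 : al1 z ^ 3 = 1 := by
    funext i; fin_cases i <;> simp [al1, ← pow_mul, z9]
  have a2 : al2 z ^ 9 = 1 := by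
    have z27 : z ^ 27 = 1 := by rw [show 27 = 9 * 3 by norm_num, pow_mul, z9, one_pow]
    have z18 : z ^ 18 = 1 := by rw [show 18 = 9 * 2 by norm_num, pow_mul, z9, one_pow]
    funext i; fin_cases i <;> simp [al2, ← pow_mul, z9, z27, z18]
  have a3 : al3 z ^ 3 = 1 := by
    funext i; fin_cases i <;> simp [al3, ← pow_mul, z9]
  apply Set.Subset.antisymm
  · intro g hg
    have : ∃ l m n : ℤ, g = al1 z ^ l * al2 z ^ m * al3 z ^ n := by
      rw [SetLike.mem_coe] at hg
      induction hg using Subgroup.closure_induction with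
      | mem x hx =>
        rcases hx with rfl | rfl | rfl
        · exact ⟨1, 0, 0, by simp [al1]⟩
        · exact ⟨0, 1, 0, by simp [al2]⟩
        · exact ⟨0, 0, 1, by simp [al3]⟩
      | one => exact ⟨0, 0, 0, by simp⟩
      | mul x y _ _ hx hy =>
        obtain ⟨l, m, n, rfl⟩ := hx
        obtain ⟨l', m', n', rfl⟩ := hy
        refine ⟨l + l', m + m', n + n', ?_⟩
        simp only [zpow_add]
        ac_rfl
      | inv x _ hx =>
        obtain ⟨l, m, n, rfl⟩ := hx
        refine ⟨-l, -m, -n, ?_⟩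
        simp only [zpow_neg, mul_inv]
    obtain ⟨l, m, n, rfl⟩ := this
    obtain ⟨i, hi⟩ := zpow_red _ 3 (by norm_num) a1 l
    obtain ⟨j, hj⟩ := zpow_red _ 9 (by norm_num) a2 m
    obtain ⟨k, hk⟩ := zpow_red _ 3 (by norm_num) a3 n
    exact ⟨(i, j, k), by simp only [ee, hi, hj, hk]⟩
  · rintro _ ⟨t, rfl⟩
    refine Subgroup.mul_mem _ (Subgroup.mul_mem _ ?_ ?_) ?_ <;> apply Subgroup.pow_mem <;>
      apply Subgroup.subset_closure <;> simp [al1, al2, al3]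

theorem Gsub_prop (z : ℂˣ) (hz : IsPrimitiveRoot z 9) (g : Fin 6 → ℂˣ) (hg : g ∈ Gsub z) :
    g 0 = 1 ∧ g 1 ^ 3 = 1 ∧ g 2 ^ 3 = 1 ∧ g 3 * g 4 * g 5 = 1 ∧
      g 3 ^ 3 = g 0 * g 1 * g 2 ∧ g 4 ^ 3 = g 0 * g 1 * g 2 ∧ g 5 ^ 3 = g 0 * g 1 * g 2 := by
  have z9 : z ^ 9 = 1 := hz.pow_eq_one
  have z6 : (z ^ 6)⁻¹ = z ^ 3 := by
    rw [inv_eq_iff_mul_eq_one, ← pow_add]; exact z9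
  have z33 : z * z = z ^ 2 := (pow_two z).symm
  induction hg using Subgroup.closure_induction with
  | mem x hx =>
    rcases hx with rfl | rfl | rfl <;> simp [← pow_mul, z9, z6, z33]
  | one => simp
  | mul x y _ _ hx hy =>
    obtain ⟨x0, x1, x2, x3, x4, x5, x6⟩ := hx
    obtain ⟨y0, y1, y2, y3, y4, y5, y6⟩ := hy
    simp only [Pi.mul_apply, mul_pow, x0, x1, x2, x4, x5, x6, y0, y1, y2, y4, y5, y6]
    refine ⟨by simp, by simp, by simp, ?_, ?_, ?_, ?_⟩
    · calc _ = (x 3 * x 4 * x 5) * (y 3 * y 4 * y 5) := by ac_rfl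
        _ = 1 := by rw [x3, y3, one_mul]
    all_goals simp only [one_mul]; ac_rfl
  | inv x _ hx =>
    obtain ⟨x0, x1, x2, x3, x4, x5, x6⟩ := hx
    simp only [Pi.inv_apply, inv_pow, x0, x1, x2, x4, x5, x6, ← mul_inv, x3]
    simp

theorem line_FG (l a b c p : ℂ) (hl : l ≠ 0) (hc : c ≠ 0) (h : lineEqs l a b c p)
    (x : Fin 6 → ℂ) (hx : x ∈ linePlane a b c p) : Fcubic l x = 0 ∧ Gcubic l x = 0 := by
  obtain ⟨h1, h2, h3, h4⟩ := h
  unfold linePlane at hx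
  rw [Submodule.mem_span_pair] at hx
  obtain ⟨s, t, rfl⟩ := hx
  have k1 : l * b = -2 * p ^ 2 * c := by
    apply mul_left_cancel₀ hl
    linear_combination h2 + 2 * c * h1
  have k2 : 2 * c ^ 3 + 1 - 3 * l * a ^ 2 * b = 0 := by
    apply mul_left_cancel₀ hl
    linear_combination -h3 - 3 * a ^ 2 * h2
  have k3 : 2 * a ^ 3 + b ^ 3 - 3 * l * c ^ 2 = 0 := by
    have hl6 : 12 * c * l ^ 6 ≠ 0 := by simp [hl, hc]
    apply mul_left_cancel₀ hl6
    have hb3 : l ^ 6 * b ^ 3 = 64 * a ^ 3 * c ^ 3 := by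
      have := congrArg (· ^ 3) h2
      linear_combination this
    linear_combination 12 * c * hb3 + (2 * l ^ 6 + 64 * c ^ 3) * h3 + 2 * l * h4
  constructor
  · simp [Fcubic]
    linear_combination t ^ 3 * k3 + 3 * s ^ 2 * t * h1
  · simp [Gcubic]
    linear_combination t ^ 3 * k2 + 3 * s ^ 2 * t * k1

theorem perm_FG (l : ℂ) (σ : Equiv.Perm (Fin 6)) (hσ : blk σ) (x : Fin 6 → ℂ) :
    Fcubic l (permMap σ x) = Fcubic l x ∧ Gcubic l (permMap σ x) = Gcubic l x := by
  obtain ⟨m1, m2⟩ := blk_vals σ hσ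
  simp only [List.mem_cons, Prod.mk.injEq, List.not_mem_nil, or_false] at m1 m2
  simp only [Fcubic, Gcubic, permMap, LinearMap.funLeft_apply]
  rcases m1 with ⟨e0, e1, e2⟩ | ⟨e0, e1, e2⟩ | ⟨e0, e1, e2⟩ | ⟨e0, e1, e2⟩ | ⟨e0, e1, e2⟩ | ⟨e0, e1, e2⟩ <;>
  rcases m2 with ⟨e3, e4, e5⟩ | ⟨e3, e4, e5⟩ | ⟨e3, e4, e5⟩ | ⟨e3, e4, e5⟩ | ⟨e3, e4, e5⟩ | ⟨e3, e4, e5⟩ <;>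
  rw [e0, e1, e2, e3, e4, e5] <;> constructor <;> ring

theorem diag_FG (z : ℂˣ) (hz : IsPrimitiveRoot z 9) (l : ℂ) (g : Fin 6 → ℂˣ) (hg : g ∈ Gsub z)
    (x : Fin 6 → ℂ) : Fcubic l (diagMap g x) = Fcubic l x ∧
      Gcubic l (diagMap g x) = (g 0 * g 1 * g 2 : ℂˣ) * Gcubic l x := by
  obtain ⟨x0, x1, x2, x3, x4, x5, x6⟩ := Gsub_prop z hz g hg
  have y0 : (g 0 : ℂ) = 1 := by rw [x0]; rfl
  have y1 : (g 1 : ℂ) ^ 3 = 1 := by rw [← Units.val_pow_eq_pow_val, x1]; rfl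
  have y2 : (g 2 : ℂ) ^ 3 = 1 := by rw [← Units.val_pow_eq_pow_val, x2]; rfl
  have y3 : (g 3 : ℂ) * g 4 * g 5 = 1 := by rw [← Units.val_mul, ← Units.val_mul, x3]; rfl
  have y4 : (g 3 : ℂ) ^ 3 = g 0 * g 1 * g 2 := by rw [← Units.val_pow_eq_pow_val, x4]; simp
  have y5 : (g 4 : ℂ) ^ 3 = g 0 * g 1 * g 2 := by rw [← Units.val_pow_eq_pow_val, x5]; simp
  have y6 : (g 5 : ℂ) ^ 3 = g 0 * g 1 * g 2 := by rw [← Units.val_pow_eq_pow_val, x6]; simp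
  simp only [Fcubic, Gcubic, diagMap, LinearMap.pi_apply, LinearMap.smul_apply, LinearMap.proj_apply,
    smul_eq_mul, Units.val_mul]
  constructor
  · rw [y0]
    linear_combination x 1 ^ 3 * y1 + x 2 ^ 3 * y2 - 3 * l * x 3 * x 4 * x 5 * y3
  · linear_combination x 3 ^ 3 * y4 + x 4 ^ 3 * y5 + x 5 ^ 3 * y6

theorem rank_line (g : Fin 6 → ℂˣ) (σ : Equiv.Perm (Fin 6)) (a b c p : ℂ) :
    Module.finrank ℂ (Submodule.map (diagMap g)
      (Submodule.map (permMap σ) (linePlane a b c p))) = 2 := by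
  rw [map_line]
  have li : LinearIndependent ℂ ![(fun i => (g i : ℂ) * uu p (σ i)), (fun i => (g i : ℂ) * vv a b c (σ i))] := by
    rw [LinearIndependent.pair_iff]
    intro s t h
    have h5 := congrFun h (σ⁻¹ 5)
    have h0 := congrFun h (σ⁻¹ 0)
    simp [uu, vv] at h5 h0
    subst h5
    simpa using h0
  have := finrank_span_eq_card li
  rw [Matrix.range_cons, Matrix.range_cons, Matrix.range_empty, Set.union_empty, Set.singleton_union] at this
  simpa using this

theorem nondeg (l a b c p : ℂ) (hl : l ≠ 0) (hl6 : l ^ 6 ≠ 1) (hc : c ≠ 0) (h : lineEqs l a b c p) :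
    a ≠ 0 ∧ b ≠ 0 ∧ p ≠ 0 ∧ c - a * p ≠ 0 ∧ c + a * p ≠ 0 := by
  obtain ⟨h1, h2, h3, h4⟩ := h
  have ha : a ≠ 0 := by
    rintro rfl
    have e : 2 * c ^ 3 + 1 = 0 := by
      apply mul_right_cancel₀ hl; linear_combination -h3
    have : l ^ 6 = 0 := by
      linear_combination (h4 - (32 * c ^ 3 - 8 * l ^ 6) * e) / 9
    exact hl (pow_eq_zero_iff (by norm_num) |>.1 this)
  have hcap : c ^ 2 ≠ a ^ 2 * p ^ 2 := by
    intro e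
    have e1 : l * c ^ 2 = -2 * a ^ 3 := by linear_combination l * e + a ^ 2 * h1
    have e2 : 8 * c ^ 3 + 1 = 0 := by
      apply mul_left_cancel₀ hl; linear_combination -h3 + 6 * c * e1
    apply hl6
    linear_combination (h4 - (8 * c ^ 3 + 3 - 2 * l ^ 6) * e2) / 3
  refine ⟨ha, ?_, ?_, ?_, ?_⟩
  · rintro rfl
    have : 4 * a * c = 0 := by linear_combination -h2
    simp [ha, hc] at this
  · rintro rfl
    apply ha
    linear_combination h1 / 2
  · intro e
    apply hcap; linear_combination (c + a * p) * e
  · intro e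
    apply hcap; linear_combination (c - a * p) * e

theorem stmt_8 (z : ℂˣ) (hz : IsPrimitiveRoot (z : ℂ) 9) :
    ∃ S : Finset ℂ, (0 : ℂ) ∈ S ∧ ∀ l : ℂ, l ∉ S →
      ∀ a b c p : ℂ, c ≠ 0 → lineEqs l a b c p →
        ({w : Submodule ℂ (Fin 6 → ℂ) |
            ∃ g ∈ Gsub z, ∃ σ ∈ Hsub,
              Submodule.map (diagMap g)
                (Submodule.map (permMap σ) (linePlane a b c p)) = w}.ncard = 1458 ∧
          ∀ w : Submodule ℂ (Fin 6 → ℂ),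
            (∃ g ∈ Gsub z, ∃ σ ∈ Hsub,
              Submodule.map (diagMap g)
                (Submodule.map (permMap σ) (linePlane a b c p)) = w) →
            Module.finrank ℂ w = 2 ∧ ∀ x ∈ w, Fcubic l x = 0 ∧ Gcubic l x = 0) := by
  have hz' : IsPrimitiveRoot z 9 := IsPrimitiveRoot.coe_units_iff.1 hz
  classical
  refine ⟨insert 0 (Polynomial.nthRoots 6 (1 : ℂ)).toFinset, by simp, ?_⟩
  intro l hlS a b c p hc h
  have hl : l ≠ 0 := by
    rintro rfl; exact hlS (by simp)
  have hl6 : l ^ 6 ≠ 1 := by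
    intro e
    apply hlS
    rw [Finset.mem_insert, Multiset.mem_toFinset, Polynomial.mem_nthRoots (by norm_num)]
    exact Or.inr e
  obtain ⟨ha, hb, hp, n1, n2⟩ := nondeg l a b c p hl hl6 hc h
  constructor
  · have hT : {w : Submodule ℂ (Fin 6 → ℂ) |
            ∃ g ∈ Gsub z, ∃ σ ∈ Hsub,
              Submodule.map (diagMap g)
                (Submodule.map (permMap σ) (linePlane a b c p)) = w} =
        (fun t : (Fin 6 → ℂˣ) × Equiv.Perm (Fin 6) => Submodule.map (diagMap t.1)
                (Submodule.map (permMap t.2) (linePlane a b c p))) ''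
          ((Gsub z : Set (Fin 6 → ℂˣ)) ×ˢ (Rset : Set (Equiv.Perm (Fin 6)))) := by
      ext w
      constructor
      · rintro ⟨g, hg, σ, hσ, rfl⟩
        rw [mem_Hsub] at hσ
        by_cases hlt : σ.symm 0 < σ.symm 1
        · exact ⟨(g, σ), ⟨hg, by simp [Rset, hσ, hlt]⟩, rfl⟩
        · refine ⟨(g, tau * σ), ⟨hg, ?_⟩, tau_line g σ a b c p⟩
          have i0 : (tau * σ).symm 0 = σ.symm 1 := by
            rw [Equiv.symm_apply_eq]; simp [tau]; decide
          have i1 : (tau * σ).symm 1 = σ.symm 0 := by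
            rw [Equiv.symm_apply_eq]; simp [tau]; decide
          have ne : σ.symm 1 ≠ σ.symm 0 := by simp
          simp only [Rset, Finset.coe_filter, Finset.mem_univ, true_and, Set.mem_ofPred_eq]
          refine ⟨blk_mul blk_tau hσ, ?_⟩
          rw [i0, i1]
          exact lt_of_le_of_ne (not_lt.1 hlt) ne
      · rintro ⟨⟨g, σ⟩, ⟨hg, hσ⟩, rfl⟩
        simp only [Rset, Finset.coe_filter, Finset.mem_univ, true_and, Set.mem_ofPred_eq] at hσ
        exact ⟨g, hg, σ, (mem_Hsub σ).2 hσ.1, rfl⟩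
    rw [hT, Set.InjOn.ncard_image, Set.ncard_prod, Set.ncard_coe_finset, Rset_card,
      Gsub_eq z hz', ← Set.image_univ, Set.ncard_image_of_injective _ (ee_inj z hz'),
      Set.ncard_univ]
    · simp
    · rintro ⟨g, σ⟩ ⟨hg, hσ⟩ ⟨g', σ'⟩ ⟨hg', hσ'⟩ E
      obtain ⟨q1, q2⟩ := inj_main a b c p ha hb hc hp n1 n2 g g'
        (Gsub_prop z hz' g hg).1 (Gsub_prop z hz' g' hg').1 σ σ' hσ hσ' E
      rw [q1, q2]
  · rintro w ⟨g, hg, σ, hσ, rfl⟩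
    refine ⟨rank_line g σ a b c p, ?_⟩
    rintro x ⟨_, ⟨y, hy, rfl⟩, rfl⟩
    obtain ⟨f1, f2⟩ := line_FG l a b c p hl hc h y hy
    obtain ⟨f3, f4⟩ := perm_FG l σ ((mem_Hsub σ).1 hσ) y
    obtain ⟨f5, f6⟩ := diag_FG z hz' l g hg (permMap σ y)
    constructor
    · rw [f5, f3, f1]
    · rw [f6, f4, f2, mul_zero]
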